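/- Let n ≥ 1 and i ∈ {1,…,n}. There is a constant C = C(n) such that for every ν > 0 and every f ∈ C_c^∞((0,∞) × ℝⁿ), ess sup_{x_i ∈ ℝ} ( ∫₀^∞ ∫_{ℝ^{n-1}} |∂_{x_i}(𝓐_ν f)(t,x)|² dx̄ dt )^{1/2} ≤ C ∫_ℝ ( ∫₀^∞ ∫_{ℝ^{n-1}} |f(t,x)|² dx̄ dt )^{1/2} dx_i, where x̄ denotes the variables x_j with j ≠ i. -/

import Mathlib

open MeasureTheory

noncomputable section

/-- `e r = exp (i r)`. -/
def e (r : ℝ) : ℂ := Complex.exp (Complex.I * (r : ℂ))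

/-- Insert the value `a` in the `i`-th coordinate of `y : ℝ^{n-1}` to get a point of `ℝⁿ`. -/
def embed {n : ℕ} (i : Fin n) (a : ℝ) (y : {j : Fin n // j ≠ i} → ℝ) : Fin n → ℝ :=
  fun j => if h : j = i then a else y ⟨j, h⟩

/-- The Fourier transform in the space variable: `𝓕_x f (ξ) = ∫ e^{-ix·ξ} f x dx`. -/
def FT {n : ℕ} (f : (Fin n → ℝ) → ℂ) (ξ : Fin n → ℝ) : ℂ :=
  ∫ x : Fin n → ℝ, e (-(∑ j, x j * ξ j)) * f x

/-- `∂_{x_i} 𝓐_ν f (t,x)`, where `𝓐_ν f (t) = ∫₀ᵗ G_ν(t-τ) f(τ) dτ` is the Duhamel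
operator of the Ginzburg–Landau semigroup `G_ν(t) = 𝓕⁻¹ e^{-it|ξ|² - νt|ξ|²} 𝓕`;
for nice `f` the derivative `∂_{x_i}` is the Fourier multiplier `iξ_i`. -/
def AnuD {n : ℕ} (ν : ℝ) (i : Fin n) (f : ℝ → (Fin n → ℝ) → ℂ) (t : ℝ) (x : Fin n → ℝ) : ℂ :=
  ∫ τ in Set.Ioc (0 : ℝ) t,
    ((2 * Real.pi) ^ n)⁻¹ •
      ∫ ξ : Fin n → ℝ,
        (Complex.I * (ξ i : ℂ)) * e ((∑ j, x j * ξ j) - (t - τ) * (∑ j, ξ j ^ 2)) *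
          (Real.exp (-(ν * (t - τ) * (∑ j, ξ j ^ 2))) : ℂ) * FT (f τ) ξ

section Lemmas

open FourierTransform SchwartzMap

lemma norm_e (r : ℝ) : ‖e r‖ = 1 := by
  rw [e, mul_comm]; exact Complex.norm_exp_ofReal_mul_I r

lemma e_add (r s : ℝ) : e (r + s) = e r * e s := by
  simp [e, mul_add, Complex.exp_add]

@[fun_prop]
lemma continuous_e : Continuous e := by
  unfold e; fun_prop

lemma norm_e_mul (r : ℝ) (z : ℂ) : ‖e r * z‖ = ‖z‖ := by
  rw [norm_mul, norm_e, one_mul]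

lemma integrable_e_mul {X : Type*} [TopologicalSpace X] [MeasurableSpace X]
    [OpensMeasurableSpace X] [SecondCountableTopologyEither X ℂ] {μ : Measure X} {u : X → ℝ}
    (hu : Continuous u) {h : X → ℂ} (hh : Integrable h μ) :
    Integrable (fun x => e (u x) * h x) μ :=
  hh.bdd_mul (c := 1) (continuous_e.comp hu).aestronglyMeasurable
    (Filter.Eventually.of_forall fun _ => (norm_e _).le)

lemma fourier_eq_integral_e (f : ℝ → ℂ) (w : ℝ) :
    𝓕 f w = ∫ v, e (-(2 * Real.pi * (v * w))) * f v := by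
  rw [Real.fourier_real_eq_integral_exp_smul]
  refine integral_congr_ae (Filter.Eventually.of_forall fun v => ?_)
  simp only [e, smul_eq_mul]
  congr 2
  push_cast; ring

lemma fourierInv_eq_integral_e (f : ℝ → ℂ) (w : ℝ) :
    𝓕⁻ f w = ∫ v, e (2 * Real.pi * (v * w)) * f v := by
  rw [Real.fourierInv_eq']
  refine integral_congr_ae (Filter.Eventually.of_forall fun v => ?_)
  simp only [e, smul_eq_mul]
  congr 2
  simp only [RCLike.inner_apply, conj_trivial]
  push_cast; ring

/-- Fourier inversion applied to a product: the inverse transform of `𝓕 k * 𝓕 g` is the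
convolution of `k` and `g`. -/
lemma integral_e_mul_fourier_mul_fourier {k g : ℝ → ℂ} (hk : Integrable k)
    (hgc : Continuous g) (hg : Integrable g) (hg' : Integrable (𝓕 g)) (a : ℝ) :
    ∫ ξ, e (2 * Real.pi * (a * ξ)) * (𝓕 k ξ * 𝓕 g ξ) = ∫ b, k b * g (a - b) := by
  have hψ : Integrable (fun ξ => e (2 * Real.pi * (a * ξ)) * 𝓕 g ξ) :=
    integrable_e_mul (by fun_prop) hg'
  have h := VectorFourier.integral_fourierIntegral_smul_eq_flip (L := innerₗ ℝ)
    Real.continuous_fourierChar continuous_inner hk hψ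
  calc _ = ∫ ξ, 𝓕 k ξ • (e (2 * Real.pi * (a * ξ)) * 𝓕 g ξ) := by
        congr 1; ext ξ; simp only [smul_eq_mul]; ring
    _ = _ := h
    _ = _ := by
        rw [flip_innerₗ]
        congr 1; ext b
        rw [smul_eq_mul]
        congr 1
        change 𝓕 (fun ξ => e (2 * Real.pi * (a * ξ)) * 𝓕 g ξ) b = _
        rw [fourier_eq_integral_e]
        conv_rhs => rw [← hgc.fourierInv_fourier_eq hg hg', fourierInv_eq_integral_e]
        congr 1; ext v
        rw [← mul_assoc, ← e_add]
        congr 2; ring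

/-- The causal exponential kernel. -/
def causalExp (z : ℂ) : ℝ → ℂ := (Set.Ioi 0).indicator fun b => Complex.exp (-z * b)

lemma integrable_causalExp {z : ℂ} (hz : 0 < z.re) : Integrable (causalExp z) := by
  rw [causalExp, integrable_indicator_iff measurableSet_Ioi]
  exact integrableOn_exp_mul_complex_Ioi (by simpa using hz) 0

lemma norm_causalExp_le {z : ℂ} (hz : 0 < z.re) (b : ℝ) : ‖causalExp z b‖ ≤ 1 := by
  rw [causalExp, Set.indicator_apply]
  split_ifs with h
  · rw [Complex.norm_exp, Real.exp_le_one_iff]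
    have : 0 < z.re * b := mul_pos hz h
    simp; linarith
  · simp

lemma fourier_causalExp {z : ℂ} (hz : 0 < z.re) (w : ℝ) :
    𝓕 (causalExp z) w = (z + 2 * Real.pi * w * Complex.I)⁻¹ := by
  have h0 : (-(z + 2 * Real.pi * w * Complex.I)).re < 0 := by simpa using hz
  have := integral_exp_mul_complex_Ioi h0 0
  rw [fourier_eq_integral_e]
  calc _ = ∫ v, (Set.Ioi 0).indicator
          (fun v : ℝ => Complex.exp (-(z + 2 * Real.pi * w * Complex.I) * v)) v := by
        congr 1; ext v
        simp only [causalExp, Set.indicator_apply]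
        split_ifs
        · rw [e, ← Complex.exp_add]; congr 1; push_cast; ring
        · simp
    _ = _ := by
        rw [integral_indicator measurableSet_Ioi, this, Complex.ofReal_zero, mul_zero,
          Complex.exp_zero, neg_div_neg_eq, one_div]

/-- The odd exponential kernel `sgn b * exp (-z |b|)`. -/
def oddExp (z : ℂ) (b : ℝ) : ℂ := causalExp z b - causalExp z (-b)

lemma integrable_oddExp {z : ℂ} (hz : 0 < z.re) : Integrable (oddExp z) :=
  (integrable_causalExp hz).sub (integrable_causalExp hz).comp_neg

lemma norm_oddExp_le {z : ℂ} (hz : 0 < z.re) (b : ℝ) : ‖oddExp z b‖ ≤ 1 := by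
  rcases le_or_gt b 0 with h | h
  · have : causalExp z b = 0 := by simp [causalExp, h]
    rw [oddExp, this, zero_sub, norm_neg]
    exact norm_causalExp_le hz _
  · have : causalExp z (-b) = 0 := by simp [causalExp, h.le]
    rw [oddExp, this, sub_zero]
    exact norm_causalExp_le hz _

lemma fourier_oddExp {z : ℂ} (hz : 0 < z.re) (w : ℝ) :
    𝓕 (oddExp z) w = -(4 * Real.pi * w * Complex.I) / (z ^ 2 + 4 * Real.pi ^ 2 * w ^ 2) := by
  have hneg : ∫ v, e (-(2 * Real.pi * (v * w))) * causalExp z (-v)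
      = 𝓕 (causalExp z) (-w) := by
    rw [fourier_eq_integral_e, ← integral_neg_eq_self]
    congr 1; ext v; simp
  have h1 : z + 2 * Real.pi * w * Complex.I ≠ 0 := fun h => by
    have := congrArg Complex.re h; simp at this; linarith
  have h2 : z + 2 * Real.pi * ((-w : ℝ) : ℂ) * Complex.I ≠ 0 := fun h => by
    have := congrArg Complex.re h; simp at this; linarith
  have h3 : (z + 2 * Real.pi * w * Complex.I) * (z + 2 * Real.pi * ((-w : ℝ) : ℂ) * Complex.I)
      = z ^ 2 + 4 * Real.pi ^ 2 * w ^ 2 := by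
    push_cast; ring_nf; rw [Complex.I_sq]; ring
  rw [fourier_eq_integral_e]
  simp only [oddExp, mul_sub]
  rw [integral_sub (integrable_e_mul (by fun_prop) (integrable_causalExp hz))
    (integrable_e_mul (by fun_prop) (integrable_causalExp hz).comp_neg), hneg,
    ← fourier_eq_integral_e, fourier_causalExp hz, fourier_causalExp hz, ← h3]
  rw [inv_sub_inv h1 h2]
  congr 1
  push_cast; ring

/-- Plancherel's theorem for the Fourier integral of a function in `L¹ ∩ L²`. -/
lemma eLpNorm_fourier_eq {V : Type*} [NormedAddCommGroup V] [InnerProductSpace ℝ V]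
    [FiniteDimensional ℝ V] [MeasurableSpace V] [BorelSpace V] {h : V → ℂ}
    (h1 : Integrable h) (h2 : MemLp h 2 volume) :
    eLpNorm (𝓕 h) 2 volume = eLpNorm h 2 volume := by
  set u : Lp ℂ 2 (volume : Measure V) := h2.toLp h with hu
  have hcont : Continuous (𝓕 h) :=
    VectorFourier.fourierIntegral_continuous Real.continuous_fourierChar continuous_inner h1
  have hae : 𝓕 h =ᵐ[volume] (𝓕 u : Lp ℂ 2 (volume : Measure V)) := by
    refine ae_eq_of_integral_contDiff_smul_eq hcont.locallyIntegrable
      ((Lp.memLp (𝓕 u : Lp ℂ 2 (volume : Measure V))).locallyIntegrable (by norm_num)) fun φ hφ hφc => ?_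
    have hφ' : ContDiff ℝ (⊤ : ℕ∞) (fun x => (φ x : ℂ)) :=
      Complex.ofRealCLM.contDiff.comp hφ
    have hφc' : HasCompactSupport (fun x => (φ x : ℂ)) :=
      hφc.comp_left (g := fun r : ℝ => (r : ℂ)) (by simp)
    let Φ : 𝓢(V, ℂ) := hφc'.toSchwartzMap hφ'
    have hΦ : ∀ x, Φ x = φ x := fun x => rfl
    have key := congrArg (fun T => T Φ) (Lp.fourier_toTemperedDistribution_eq u)
    simp only [TemperedDistribution.fourier_apply, Lp.toTemperedDistribution_apply] at key
    have flip := VectorFourier.integral_fourierIntegral_smul_eq_flip (L := innerₗ V)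
      Real.continuous_fourierChar continuous_inner (Φ.integrable (μ := volume)) h1
    rw [flip_innerₗ] at flip
    calc ∫ x, φ x • 𝓕 h x = ∫ x, Φ x • 𝓕 h x := by
          congr 1
      _ = ∫ x, (𝓕 Φ) x • h x := flip.symm
      _ = ∫ x, (𝓕 Φ) x • u x := by
          refine integral_congr_ae ?_
          filter_upwards [h2.coeFn_toLp] with x hx
          rw [hu, hx]
      _ = _ := key
      _ = _ := by congr 1
  rw [eLpNorm_congr_ae hae, ← eLpNorm_congr_ae h2.coeFn_toLp]
  have := Lp.norm_fourier_eq u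
  rw [Lp.norm_def, Lp.norm_def] at this
  exact (ENNReal.toReal_eq_toReal_iff' (Lp.eLpNorm_ne_top _) (Lp.eLpNorm_ne_top _)).1 this

/-- The Euclidean inner product on `ℝ × ℝ^ι`. -/
def spDot {ι : Type*} [Fintype ι] (p q : ℝ × (ι → ℝ)) : ℝ := p.1 * q.1 + ∑ j, p.2 j * q.2 j

lemma continuous_spDot {ι : Type*} [Fintype ι] (q : ℝ × (ι → ℝ)) :
    Continuous fun p => spDot p q := by
  unfold spDot; fun_prop

lemma continuous_spDot_right {ι : Type*} [Fintype ι] (q : ℝ × (ι → ℝ)) :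
    Continuous fun p => spDot q p := by
  unfold spDot; fun_prop

/-- The Fourier transform on `ℝ × ℝ^ι`. -/
def prodFourier {ι : Type*} [Fintype ι] (h : ℝ × (ι → ℝ) → ℂ) (p : ℝ × (ι → ℝ)) : ℂ :=
  ∫ q, e (-(2 * Real.pi * spDot q p)) * h q

/-- The identification of `ℝ × ℝ^ι` with a Euclidean space. -/
def toEuclid (ι : Type*) [Fintype ι] :
    (ℝ × (ι → ℝ)) ≃L[ℝ] WithLp 2 (ℝ × EuclideanSpace ℝ ι) :=
  ((ContinuousLinearEquiv.refl ℝ ℝ).prodCongr (EuclideanSpace.equiv ι ℝ).symm).trans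
    (WithLp.prodContinuousLinearEquiv 2 ℝ ℝ (EuclideanSpace ℝ ι)).symm

lemma measurePreserving_toEuclid (ι : Type*) [Fintype ι] :
    MeasurePreserving (toEuclid ι) := by
  have h1 : MeasurePreserving (Prod.map id (WithLp.toLp 2) :
      ℝ × (ι → ℝ) → ℝ × EuclideanSpace ℝ ι) :=
    (MeasurePreserving.id volume).prod (PiLp.volume_preserving_toLp ι)
  exact (WithLp.volume_preserving_toLp ℝ (EuclideanSpace ℝ ι)).comp h1

lemma measurableEmbedding_toEuclid (ι : Type*) [Fintype ι] :
    MeasurableEmbedding (toEuclid ι) :=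
  (toEuclid ι).toHomeomorph.measurableEmbedding

lemma inner_toEuclid {ι : Type*} [Fintype ι] (p q : ℝ × (ι → ℝ)) :
    inner ℝ (toEuclid ι p) (toEuclid ι q) = spDot p q := by
  simp [toEuclid, spDot, WithLp.prod_inner_apply, PiLp.inner_apply, mul_comm]

lemma prodFourier_eq_fourier {ι : Type*} [Fintype ι] (h : ℝ × (ι → ℝ) → ℂ)
    (p : ℝ × (ι → ℝ)) :
    prodFourier h p = 𝓕 (h ∘ (toEuclid ι).symm) (toEuclid ι p) := by
  rw [Real.fourier_eq', ← (measurePreserving_toEuclid ι).integral_comp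
    (measurableEmbedding_toEuclid ι), prodFourier]
  congr 1; ext q
  rw [inner_toEuclid]
  simp only [e, smul_eq_mul, Function.comp, ContinuousLinearEquiv.symm_apply_apply]
  congr 2
  push_cast; ring

/-- Plancherel's theorem on `ℝ × ℝ^ι`. -/
lemma lintegral_prodFourier_sq {ι : Type*} [Fintype ι] {h : ℝ × (ι → ℝ) → ℂ}
    (h1 : Integrable h) (h2 : MemLp h 2 volume) :
    ∫⁻ p, ‖prodFourier h p‖ₑ ^ 2 = ∫⁻ p, ‖h p‖ₑ ^ 2 := by
  have mp := measurePreserving_toEuclid ι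
  have me := measurableEmbedding_toEuclid ι
  have hcomp : (h ∘ (toEuclid ι).symm) ∘ toEuclid ι = h := by
    ext p; simp
  have h1' : Integrable (h ∘ (toEuclid ι).symm) :=
    (mp.integrable_comp_emb me).1 (by rwa [hcomp])
  have h2' : MemLp (h ∘ (toEuclid ι).symm) 2 volume := by
    rw [← mp.map_eq, me.memLp_map_measure_iff, hcomp]
    exact h2
  have key := eLpNorm_fourier_eq h1' h2'
  rw [eLpNorm_eq_lintegral_rpow_enorm_toReal (by norm_num) (by norm_num),
    eLpNorm_eq_lintegral_rpow_enorm_toReal (by norm_num) (by norm_num)] at key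
  have hsq := (ENNReal.rpow_left_injective (by norm_num)) key
  simp only [ENNReal.toReal_ofNat, ENNReal.rpow_ofNat] at hsq
  rw [← mp.lintegral_comp_emb me, ← mp.lintegral_comp_emb me] at hsq
  simpa [prodFourier_eq_fourier] using hsq

/-- Plancherel's theorem for the inverse transform on `ℝ × ℝ^ι`. -/
lemma lintegral_prodFourierInv_sq {ι : Type*} [Fintype ι] {h : ℝ × (ι → ℝ) → ℂ}
    (h1 : Integrable h) (h2 : MemLp h 2 volume) :
    ∫⁻ p, ‖∫ q, e (2 * Real.pi * spDot p q) * h q‖ₑ ^ 2 = ∫⁻ p, ‖h p‖ₑ ^ 2 := by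
  have hneg : (volume : Measure (ℝ × (ι → ℝ))).IsNegInvariant :=
    ⟨((Measure.measurePreserving_neg (volume : Measure ℝ)).prod
      (Measure.measurePreserving_neg (volume : Measure (ι → ℝ)))).map_eq⟩
  rw [← lintegral_prodFourier_sq h1 h2,
    ← lintegral_neg_eq_self (fun p => ‖prodFourier h p‖ₑ ^ 2)]
  congr 1; ext p
  congr 3; ext q
  congr 2
  simp [spDot, Finset.sum_neg_distrib, mul_comm]
  ring

/-- Rapid decay of the Fourier transform of a test function on `ℝ × ℝ^ι`. -/
lemma exists_norm_prodFourier_le {ι : Type*} [Fintype ι] {h : ℝ × (ι → ℝ) → ℂ}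
    (hs : ContDiff ℝ (⊤ : ℕ∞) h) (hc : HasCompactSupport h) (k : ℕ) :
    ∃ C, 0 < C ∧ ∀ σ η, ‖prodFourier h (σ, η)‖ ≤ C * ((1 + σ ^ 2)⁻¹ * ((1 + ‖η‖) ^ k)⁻¹) := by
  have hs' : ContDiff ℝ (⊤ : ℕ∞) (h ∘ (toEuclid ι).symm) :=
    hs.comp (toEuclid ι).symm.contDiff
  have hc' : HasCompactSupport (h ∘ (toEuclid ι).symm) :=
    hc.comp_homeomorph (toEuclid ι).symm.toHomeomorph
  let Φ : 𝓢(WithLp 2 (ℝ × EuclideanSpace ℝ ι), ℂ) := hc'.toSchwartzMap hs'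
  have hΦ : ∀ p, prodFourier h p = (𝓕 Φ) (toEuclid ι p) := fun p => by
    rw [prodFourier_eq_fourier, SchwartzMap.fourier_coe]; rfl
  set B := 2 ^ (k + 2) * ((Finset.Iic (k + 2, 0)).sup
    fun m => SchwartzMap.seminorm ℝ m.1 m.2) (𝓕 Φ) with hB
  have hdec : ∀ x, (1 + ‖x‖) ^ (k + 2) * ‖(𝓕 Φ) x‖ ≤ B := fun x => by
    simpa using SchwartzMap.one_add_le_sup_seminorm_apply (𝕜 := ℝ) (m := (k + 2, 0))
      (k := k + 2) (n := 0) le_rfl le_rfl (𝓕 Φ) x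
  set M : ℝ := max 1 ‖((toEuclid ι).symm : WithLp 2 (ℝ × EuclideanSpace ℝ ι) →L[ℝ] ℝ × (ι → ℝ))‖ with hM
  have hM1 : 1 ≤ M := le_max_left _ _
  have hle : ∀ p : ℝ × (ι → ℝ), 1 + ‖p‖ ≤ M * (1 + ‖toEuclid ι p‖) := fun p => by
    have h1 := ((toEuclid ι).symm : WithLp 2 (ℝ × EuclideanSpace ℝ ι) →L[ℝ] ℝ × (ι → ℝ)).le_opNorm (toEuclid ι p)
    have h2 : ‖p‖ ≤ M * ‖toEuclid ι p‖ := by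
      refine le_trans ?_ (h1.trans ?_)
      · simp
      · gcongr; exact le_max_right _ _
    linarith
  have hB0 : 0 ≤ B := le_trans (by positivity) (hdec 0)
  refine ⟨M ^ (k + 2) * (B + 1), by positivity, fun σ η => ?_⟩
  have hσ : 1 + σ ^ 2 ≤ (1 + ‖(σ, η)‖) ^ 2 := by
    have : |σ| ≤ ‖(σ, η)‖ := norm_fst_le (σ, η)
    have h0 := abs_nonneg σ
    rw [← sq_abs]; nlinarith
  have hη : (1 + ‖η‖) ^ k ≤ (1 + ‖(σ, η)‖) ^ k := by
    gcongr; exact norm_snd_le (σ, η)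
  have hpos : 0 < (1 + σ ^ 2) * (1 + ‖η‖) ^ k := by positivity
  rw [← mul_inv, ← div_eq_mul_inv, le_div_iff₀ hpos, hΦ]
  calc ‖(𝓕 Φ) (toEuclid ι (σ, η))‖ * ((1 + σ ^ 2) * (1 + ‖η‖) ^ k)
      ≤ ‖(𝓕 Φ) (toEuclid ι (σ, η))‖ * ((1 + ‖(σ, η)‖) ^ 2 * (1 + ‖(σ, η)‖) ^ k) := by gcongr
    _ = ‖(𝓕 Φ) (toEuclid ι (σ, η))‖ * (1 + ‖(σ, η)‖) ^ (k + 2) := by ring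
    _ ≤ ‖(𝓕 Φ) (toEuclid ι (σ, η))‖ * (M * (1 + ‖toEuclid ι (σ, η)‖)) ^ (k + 2) := by
        gcongr; exact hle _
    _ = M ^ (k + 2) * ((1 + ‖toEuclid ι (σ, η)‖) ^ (k + 2) *
          ‖(𝓕 Φ) (toEuclid ι (σ, η))‖) := by rw [mul_pow]; ring
    _ ≤ M ^ (k + 2) * (B + 1) := by
        gcongr; exact (hdec _).trans (by linarith)

lemma continuous_prodFourier {ι : Type*} [Fintype ι] {h : ℝ × (ι → ℝ) → ℂ}
    (hh : Integrable h) : Continuous (prodFourier h) := by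
  unfold prodFourier
  refine continuous_of_dominated (bound := fun q => ‖h q‖) (fun p => ?_) (fun p => ?_) hh.norm ?_
  · exact (integrable_e_mul (by have := continuous_spDot p; fun_prop) hh).aestronglyMeasurable
  · exact Filter.Eventually.of_forall fun q => (norm_e_mul _ _).le
  · refine Filter.Eventually.of_forall fun q => ?_
    have := continuous_spDot_right q
    fun_prop

/-- Partial integrals of compactly supported continuous functions. -/
lemma continuous_integral_of_hasCompactSupport {B G : Type*} [TopologicalSpace B]
    [SecondCountableTopology B] [MeasurableSpace B] [OpensMeasurableSpace B] {μ : Measure B}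
    [IsFiniteMeasureOnCompacts μ] [IsLocallyFiniteMeasure μ] [NormedAddCommGroup G] [NormedSpace ℝ G]
    {h : ℝ × B → G} (hc : Continuous h) (hs : HasCompactSupport h) :
    Continuous (fun a => ∫ b, h (a, b) ∂μ) ∧ HasCompactSupport (fun a => ∫ b, h (a, b) ∂μ) := by
  have hz : ∀ a b, b ∉ Prod.snd '' tsupport h → h (a, b) = 0 := fun a b hb => by
    by_contra hne
    exact hb ⟨(a, b), subset_tsupport _ hne, rfl⟩
  have hz' : ∀ a b, a ∉ Prod.fst '' tsupport h → h (a, b) = 0 := fun a b hb => by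
    by_contra hne
    exact hb ⟨(a, b), subset_tsupport _ hne, rfl⟩
  have hK : IsCompact (Prod.snd '' tsupport h) := hs.isCompact.image continuous_snd
  constructor
  · have := continuous_parametric_integral_of_continuous (μ := μ) (f := fun a b => h (a, b))
      (by exact hc) hK
    convert this using 2 with a
    exact (setIntegral_eq_integral_of_forall_compl_eq_zero fun b hb => hz a b hb).symm
  · refine HasCompactSupport.intro (hs.isCompact.image continuous_fst) fun a ha => ?_
    simp [hz' a _ ha]

section Embed

variable {n : ℕ} (i : Fin n)

lemma measurePreserving_embed :
    MeasurePreserving (fun p : ℝ × ({j : Fin n // j ≠ i} → ℝ) => embed i p.1 p.2) := by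
  let _ : Unique {j : Fin n // ¬ j ≠ i} := ⟨⟨⟨i, by simp⟩⟩, fun j => Subtype.ext (by simpa using j.2)⟩
  have h1 := (volume_preserving_piEquivPiSubtypeProd (fun _ : Fin n => ℝ) (fun j => j ≠ i)).symm
  have h2 : MeasurePreserving (MeasurableEquiv.funUnique {j : Fin n // ¬ j ≠ i} ℝ).symm := by
    convert (volume_preserving_funUnique {j : Fin n // ¬ j ≠ i} ℝ).symm
    all_goals rfl
  have h3 : MeasurePreserving (Prod.map (id : ({j : Fin n // j ≠ i} → ℝ) → _)
      (MeasurableEquiv.funUnique {j : Fin n // ¬ j ≠ i} ℝ).symm) :=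
    (MeasurePreserving.id volume).prod h2
  have h4 : MeasurePreserving (Prod.swap : ℝ × ({j : Fin n // j ≠ i} → ℝ) → _) :=
    Measure.measurePreserving_swap
  convert (h1.comp h3).comp h4 using 1
  ext p j
  by_cases h : j = i <;>
    simp [embed, h, MeasurableEquiv.piEquivPiSubtypeProd, Equiv.piEquivPiSubtypeProd]

lemma continuous_embed :
    Continuous (fun p : ℝ × ({j : Fin n // j ≠ i} → ℝ) => embed i p.1 p.2) := by
  refine continuous_pi fun j => ?_
  by_cases h : j = i
  · simp only [embed, h, dite_true]; fun_prop
  · simp only [embed, h, dite_false]; fun_prop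

@[simp] lemma embed_self (a : ℝ) (y : {j : Fin n // j ≠ i} → ℝ) : embed i a y i = a := by
  simp [embed]

lemma sum_embed (φ : ℝ → ℝ → ℝ) (a b : ℝ) (y z : {j : Fin n // j ≠ i} → ℝ) :
    ∑ j, φ (embed i a y j) (embed i b z j) = φ a b + ∑ j, φ (y j) (z j) := by
  rw [Fintype.sum_eq_add_sum_subtype_ne _ i, embed_self, embed_self]
  congr 1
  refine Finset.sum_congr rfl fun j _ => ?_
  have := j.2
  simp [embed, this]

end Embed

lemma exists_sq_eq_of_mem_slitPlane {w : ℂ} (hw : w ∈ Complex.slitPlane) :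
    ∃ z : ℂ, 0 < z.re ∧ z ^ 2 = w := by
  obtain ⟨z, hz⟩ := IsAlgClosed.exists_pow_nat_eq w (n := 2) (by norm_num)
  have hre : z.re ≠ 0 := fun h => by
    rw [← hz, Complex.mem_slitPlane_iff] at hw
    simp [sq, h] at hw
    nlinarith [sq_nonneg z.im]
  rcases lt_or_gt_of_ne hre with h | h
  · exact ⟨-z, by simpa using h, by rw [neg_sq, hz]⟩
  · exact ⟨z, h, hz⟩

/-- The symbol of the space-time operator `∂_t - (i + ν) Δ`, as a function of the time
frequency and of the squared length of the space frequency. -/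
def glSymbol (ν σ s : ℝ) : ℂ :=
  (ν + Complex.I) * (4 * Real.pi ^ 2 * s) + 2 * Real.pi * σ * Complex.I

lemma exists_glSymbol_eq {ν σ s : ℝ} (hν : 0 < ν) (hσ : σ ≠ 0) :
    ∃ z : ℂ, 0 < z.re ∧ ∀ r : ℝ,
      glSymbol ν σ (r ^ 2 + s) = (ν + Complex.I) * (z ^ 2 + 4 * Real.pi ^ 2 * r ^ 2) := by
  have hI : (ν + Complex.I : ℂ) ≠ 0 := fun h => by
    have := congrArg Complex.im h; simp at this
  have hN : 0 < ν ^ 2 + 1 := by positivity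
  have hw : (((4 * Real.pi ^ 2 * s + 2 * Real.pi * σ / (ν ^ 2 + 1) : ℝ) : ℂ)
      + ((2 * Real.pi * σ * ν / (ν ^ 2 + 1) : ℝ) : ℂ) * Complex.I) ∈ Complex.slitPlane := by
    have hgen : ∀ x y : ℝ, y ≠ 0 → (x + y * Complex.I : ℂ) ∈ Complex.slitPlane := fun x y hy => by
      rw [Complex.mem_slitPlane_iff]; simp [hy]
    exact hgen _ _ (by have := Real.pi_ne_zero; have := hν.ne'; have := hN.ne'; positivity)
  obtain ⟨z, hz, hzw⟩ := exists_sq_eq_of_mem_slitPlane hw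
  refine ⟨z, hz, fun r => ?_⟩
  rw [hzw, glSymbol]
  have hN' : ((ν : ℂ) ^ 2 + 1) ≠ 0 := by exact_mod_cast hN.ne'
  push_cast
  field_simp
  ring_nf
  simp only [Complex.I_sq]
  ring

/-- The one-dimensional resolvent bound behind the smoothing effect. -/
lemma norm_integral_resolvent_le {ν σ s : ℝ} (hν : 0 < ν) (hσ : σ ≠ 0)
    {g : ℝ → ℂ} (hgc : Continuous g) (hg : Integrable g) (hg' : Integrable (𝓕 g)) (a : ℝ) :
    ‖∫ r, e (2 * Real.pi * (a * r)) *
      (2 * Real.pi * r * Complex.I * 𝓕 g r / glSymbol ν σ (r ^ 2 + s))‖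
      ≤ 2⁻¹ * ∫ b, ‖g b‖ := by
  obtain ⟨z, hz, hsym⟩ := exists_glSymbol_eq (s := s) hν hσ
  have hI : (ν + Complex.I : ℂ) ≠ 0 := fun h => by
    have := congrArg Complex.im h; simp at this
  have hI1 : 1 ≤ ‖(ν + Complex.I : ℂ)‖ := by
    simpa using Complex.abs_im_le_norm (ν + Complex.I : ℂ)
  set c : ℂ := -(2 * (ν + Complex.I))⁻¹ with hc
  have hcn : ‖c‖ ≤ 2⁻¹ := by
    rw [hc, norm_neg, norm_inv, norm_mul, Complex.norm_ofNat]
    exact inv_anti₀ (by norm_num) (by linarith)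
  have h1 : ∀ r : ℝ, e (2 * Real.pi * (a * r)) *
      (2 * Real.pi * r * Complex.I * 𝓕 g r / glSymbol ν σ (r ^ 2 + s))
      = c * (e (2 * Real.pi * (a * r)) * (𝓕 (oddExp z) r * 𝓕 g r)) := fun r => by
    rw [fourier_oddExp hz, hsym, hc, mul_inv]
    simp only [div_eq_mul_inv, mul_inv]
    ring
  simp only [h1]
  rw [integral_const_mul, integral_e_mul_fourier_mul_fourier (integrable_oddExp hz) hgc hg hg',
    norm_mul]
  gcongr
  calc ‖∫ b, oddExp z b * g (a - b)‖ ≤ ∫ b, ‖g (a - b)‖ := by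
        refine norm_integral_le_of_norm_le (hg.comp_sub_left a).norm
          (Filter.Eventually.of_forall fun b => ?_)
        rw [norm_mul]
        exact mul_le_of_le_one_left (norm_nonneg _) (norm_oddExp_le hz b)
    _ = _ := integral_sub_left_eq_self (fun b => ‖g b‖) volume a

/-- Minkowski's integral inequality in `L²`. -/
lemma lintegral_lintegral_sq_le {Ω A : Type*} [MeasurableSpace Ω] [MeasurableSpace A]
    {μ : Measure Ω} {ρ : Measure A} [SFinite μ] [SFinite ρ] {G : Ω → A → ENNReal}
    (hG : Measurable (Function.uncurry G)) :
    ∫⁻ ω, (∫⁻ a, G ω a ∂ρ) ^ 2 ∂μ ≤ (∫⁻ a, (∫⁻ ω, G ω a ^ 2 ∂μ) ^ ((1 : ℝ) / 2) ∂ρ) ^ 2 := by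
  have hGω : ∀ ω, Measurable (G ω) := fun ω => hG.comp measurable_prodMk_left
  have hGa : ∀ a, Measurable fun ω => G ω a := fun a => hG.comp measurable_prodMk_right
  set N : A → ENNReal := fun a => (∫⁻ ω, G ω a ^ 2 ∂μ) ^ ((1 : ℝ) / 2) with hN
  have hNm : Measurable N :=
    (Measurable.lintegral_prod_left' (hG.pow_const 2)).pow_const _
  calc ∫⁻ ω, (∫⁻ a, G ω a ∂ρ) ^ 2 ∂μ
      = ∫⁻ ω, ∫⁻ a, ∫⁻ b, G ω a * G ω b ∂ρ ∂ρ ∂μ := by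
        refine lintegral_congr fun ω => ?_
        rw [sq, ← lintegral_mul_const _ (hGω ω)]
        exact lintegral_congr fun a => (lintegral_const_mul _ (hGω ω)).symm
    _ = ∫⁻ a, ∫⁻ b, ∫⁻ ω, G ω a * G ω b ∂μ ∂ρ ∂ρ := by
        rw [lintegral_lintegral_swap]
        · refine lintegral_congr fun a => ?_
          rw [lintegral_lintegral_swap]
          exact (((hGa a).comp measurable_fst).mul hG).aemeasurable
        · refine Measurable.aemeasurable ?_
          refine Measurable.lintegral_prod_right' (f := fun q : (Ω × A) × A =>
            G q.1.1 q.1.2 * G q.1.1 q.2) ?_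
          exact (hG.comp measurable_fst).mul
            (hG.comp ((measurable_fst.comp measurable_fst).prodMk measurable_snd))
    _ ≤ ∫⁻ a, ∫⁻ b, N a * N b ∂ρ ∂ρ := by
        refine lintegral_mono fun a => lintegral_mono fun b => ?_
        have := ENNReal.lintegral_mul_le_Lp_mul_Lq μ Real.HolderConjugate.two_two
          (hGa a).aemeasurable (hGa b).aemeasurable
        simpa [N] using this
    _ = _ := by
        rw [sq, ← lintegral_mul_const _ hNm]
        exact lintegral_congr fun a => lintegral_const_mul _ hNm

lemma integrable_abs_rpow_mul_inv_one_add_sq :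
    Integrable (fun σ : ℝ => |σ| ^ (-(1 / 2) : ℝ) * (1 + σ ^ 2)⁻¹) := by
  set q : ℝ → ℝ := fun σ => |σ| ^ (-(1 / 2) : ℝ) * (1 + σ ^ 2)⁻¹ with hq
  have hmeas : Measurable q := by fun_prop
  have h1 : IntegrableOn q (Set.Ioc 0 1) := by
    have := (intervalIntegrable_iff_integrableOn_Ioc_of_le zero_le_one).1
      (intervalIntegral.intervalIntegrable_rpow' (a := 0) (b := 1) (r := -(1 / 2)) (by norm_num))
    refine this.mono' hmeas.aestronglyMeasurable ?_
    filter_upwards [ae_restrict_mem measurableSet_Ioc] with σ hσ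
    rw [Real.norm_of_nonneg (by positivity), hq]
    simp only [abs_of_pos hσ.1]
    exact mul_le_of_le_one_right (Real.rpow_nonneg hσ.1.le _)
      (inv_le_one_of_one_le₀ (by nlinarith [sq_nonneg σ]))
  have h2 : IntegrableOn q (Set.Ioi 1) := by
    refine integrable_inv_one_add_sq.integrableOn.mono' hmeas.aestronglyMeasurable ?_
    filter_upwards [ae_restrict_mem measurableSet_Ioi] with σ hσ
    rw [Real.norm_of_nonneg (by positivity), hq]
    have hσ' : (1 : ℝ) < σ := hσ
    refine mul_le_of_le_one_left (by positivity) ?_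
    rw [abs_of_pos (by linarith)]
    exact Real.rpow_le_one_of_one_le_of_nonpos hσ'.le (by norm_num)
  have h3 : IntegrableOn q (Set.Ioi 0) := by
    rw [← Set.Ioc_union_Ioi_eq_Ioi zero_le_one]; exact h1.union h2
  have h4 : IntegrableOn q (Set.Iic 0) := by
    have h5 := ((integrable_indicator_iff measurableSet_Ioi).2 h3).comp_neg
    rw [integrableOn_Iic_iff_integrableOn_Iio, ← integrable_indicator_iff measurableSet_Iio]
    refine h5.congr (Filter.Eventually.of_forall fun σ => ?_)
    simp [Set.indicator_apply, hq]
  rw [← integrableOn_univ, ← Set.Iic_union_Ioi (a := (0 : ℝ))]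
  exact h4.union h3

lemma integrable_inv_one_add_norm_pow (n : ℕ) :
    Integrable (fun η : Fin n → ℝ => ((1 + ‖η‖) ^ (n + 1))⁻¹) := by
  have := integrable_one_add_norm (E := Fin n → ℝ) (μ := volume) (r := (n + 1 : ℕ))
    (by simp)
  refine this.congr (Filter.Eventually.of_forall fun η => ?_)
  simp only
  rw [Real.rpow_neg (by positivity), Real.rpow_natCast]

/-- A lower bound for the symbol. -/
lemma exists_le_norm_glSymbol {ν : ℝ} (hν : 0 < ν) :
    ∃ c, 0 < c ∧ ∀ σ s : ℝ, 0 ≤ s → c * (|σ| + s) ≤ ‖glSymbol ν σ s‖ := by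
  have hπ := Real.pi_pos
  set K : ℝ := (1 + ν⁻¹) / (2 * Real.pi) + (4 * Real.pi ^ 2 * ν)⁻¹ with hK
  have hK0 : 0 < K := by positivity
  refine ⟨K⁻¹, by positivity, fun σ s hs => ?_⟩
  rw [inv_mul_le_iff₀ hK0]
  have hform : glSymbol ν σ s = ((4 * Real.pi ^ 2 * ν * s : ℝ) : ℂ)
      + ((4 * Real.pi ^ 2 * s + 2 * Real.pi * σ : ℝ) : ℂ) * Complex.I := by
    rw [glSymbol]; push_cast; ring
  have hre : 4 * Real.pi ^ 2 * ν * s ≤ ‖glSymbol ν σ s‖ := by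
    have := Complex.abs_re_le_norm (glSymbol ν σ s)
    have h0 : (glSymbol ν σ s).re = 4 * Real.pi ^ 2 * ν * s := by
      rw [hform, Complex.add_re, Complex.ofReal_re, Complex.re_ofReal_mul, Complex.I_re]; ring
    rw [h0] at this
    exact (le_abs_self _).trans this
  have him : |4 * Real.pi ^ 2 * s + 2 * Real.pi * σ| ≤ ‖glSymbol ν σ s‖ := by
    have := Complex.abs_im_le_norm (glSymbol ν σ s)
    have h0 : (glSymbol ν σ s).im = 4 * Real.pi ^ 2 * s + 2 * Real.pi * σ := by
      rw [hform, Complex.add_im, Complex.ofReal_im, Complex.im_ofReal_mul, Complex.I_im]; ring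
    rwa [h0] at this
  set Z := ‖glSymbol ν σ s‖ with hZ
  have h1 : s ≤ (4 * Real.pi ^ 2 * ν)⁻¹ * Z := by
    rw [le_inv_mul_iff₀ (by positivity)]; exact hre
  have h2 : 2 * Real.pi * |σ| ≤ (1 + ν⁻¹) * Z := by
    have h3 : 4 * Real.pi ^ 2 * s ≤ ν⁻¹ * Z := by
      rw [le_inv_mul_iff₀ hν]; linarith
    have h4 : 2 * Real.pi * |σ| ≤ |4 * Real.pi ^ 2 * s + 2 * Real.pi * σ| + 4 * Real.pi ^ 2 * s := by
      have h5 : |2 * Real.pi * σ| = 2 * Real.pi * |σ| := by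
        rw [abs_mul, abs_of_pos (by positivity)]
      have h6 : |4 * Real.pi ^ 2 * s| = 4 * Real.pi ^ 2 * s := abs_of_nonneg (by positivity)
      have := abs_sub (4 * Real.pi ^ 2 * s + 2 * Real.pi * σ) (4 * Real.pi ^ 2 * s)
      rw [add_sub_cancel_left, h5, h6] at this
      exact this
    linarith
  have h3 : |σ| ≤ (1 + ν⁻¹) / (2 * Real.pi) * Z := by
    rw [div_mul_eq_mul_div, le_div_iff₀ (by positivity)]; linarith
  rw [hK, add_mul]
  exact add_le_add h3 h1

lemma norm_div_glSymbol_le {ν : ℝ} (hν : 0 < ν) :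
    ∃ C, 0 < C ∧ ∀ σ s r : ℝ, σ ≠ 0 → r ^ 2 ≤ s →
      ‖(2 * Real.pi * r * Complex.I) / glSymbol ν σ s‖ ≤ C * |σ| ^ (-(1 / 2) : ℝ) := by
  obtain ⟨c, hc, hle⟩ := exists_le_norm_glSymbol hν
  have hπ := Real.pi_pos
  refine ⟨2 * Real.pi / c, by positivity, fun σ s r hσ hr => ?_⟩
  have hs : 0 ≤ s := (sq_nonneg r).trans hr
  have hσ' : 0 < |σ| := abs_pos.2 hσ
  have h1 := hle σ s hs
  have hpos : 0 < c * (|σ| + s) := by positivity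
  rw [norm_div]
  have h2 : ‖(2 * Real.pi * r * Complex.I : ℂ)‖ = 2 * Real.pi * |r| := by
    simp [abs_of_pos hπ]
  have h3 : |σ| ^ (-(1 / 2) : ℝ) = (√|σ|)⁻¹ := by
    rw [Real.rpow_neg hσ'.le, Real.sqrt_eq_rpow]
  have hq : 0 < √|σ| := Real.sqrt_pos.2 hσ'
  have h4 : |r| * √|σ| ≤ |σ| + s := by
    have := Real.sq_sqrt hσ'.le
    nlinarith [sq_nonneg (|r| - √|σ|), sq_abs r]
  rw [h2, h3, div_le_iff₀ (hpos.trans_le h1)]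
  calc 2 * Real.pi * |r| = 2 * Real.pi / c * (√|σ|)⁻¹ * (c * (|r| * √|σ|)) := by field_simp
    _ ≤ 2 * Real.pi / c * (√|σ|)⁻¹ * (c * (|σ| + s)) := by gcongr
    _ ≤ _ := by gcongr

lemma continuous_glSymbol (ν : ℝ) :
    Continuous (fun p : ℝ × ℝ => glSymbol ν p.1 p.2) := by
  unfold glSymbol; fun_prop

lemma ae_fst_ne_zero {X : Type*} [MeasureSpace X] [SFinite (volume : Measure X)] :
    ∀ᵐ p : ℝ × X, p.1 ≠ 0 :=
  Measure.quasiMeasurePreserving_fst.ae (Measure.ae_ne volume (0 : ℝ))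

/-- The space-time frequency representation of `∂_{x_i} 𝓐_ν f` is absolutely convergent. -/
lemma integrable_multiplier {n : ℕ} (i : Fin n) {ν : ℝ} (hν : 0 < ν)
    {h : ℝ × (Fin n → ℝ) → ℂ} (hc : Continuous h) {C : ℝ}
    (hC : ∀ σ η, ‖h (σ, η)‖ ≤ C * ((1 + σ ^ 2)⁻¹ * ((1 + ‖η‖) ^ (n + 1))⁻¹)) :
    Integrable (fun p : ℝ × (Fin n → ℝ) =>
      2 * Real.pi * p.2 i * Complex.I * h p / glSymbol ν p.1 (∑ j, p.2 j ^ 2)) := by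
  obtain ⟨B, hB, hle⟩ := norm_div_glSymbol_le hν
  have hInt := ((integrable_abs_rpow_mul_inv_one_add_sq.mul_prod
    (integrable_inv_one_add_norm_pow n)).const_mul (B * C))
  refine hInt.mono' ?_ ?_
  · have h1 : Measurable h := hc.measurable
    have h2 : Measurable fun p : ℝ × (Fin n → ℝ) => glSymbol ν p.1 (∑ j, p.2 j ^ 2) :=
      ((continuous_glSymbol ν).comp (by fun_prop : Continuous
        fun p : ℝ × (Fin n → ℝ) => (p.1, ∑ j, p.2 j ^ 2))).measurable
    have h3 : Measurable fun p : ℝ × (Fin n → ℝ) => (2 * Real.pi * p.2 i * Complex.I : ℂ) :=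
      Continuous.measurable (by fun_prop)
    exact ((h3.mul h1).div h2).aestronglyMeasurable
  · filter_upwards [ae_fst_ne_zero] with p hp
    obtain ⟨σ, η⟩ := p
    have h1 := hle σ (∑ j, η j ^ 2) (η i) hp
      (Finset.single_le_sum (f := fun j => η j ^ 2) (fun j _ => sq_nonneg _) (Finset.mem_univ i))
    rw [mul_div_right_comm, norm_mul]
    calc _ ≤ (B * |σ| ^ (-(1 / 2) : ℝ)) * (C * ((1 + σ ^ 2)⁻¹ * ((1 + ‖η‖) ^ (n + 1))⁻¹)) :=
          mul_le_mul h1 (hC σ η) (norm_nonneg _) (by positivity)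
      _ = _ := by ring

section Slices

variable {n : ℕ} (i : Fin n)

/-- Splitting off the `i`-th space variable of a space-time point. -/
def splitHomeo : ℝ × (ℝ × ({j : Fin n // j ≠ i} → ℝ)) ≃ₜ ℝ × (Fin n → ℝ) where
  toFun p := (p.2.1, embed i p.1 p.2.2)
  invFun q := (q.2 i, (q.1, fun j => q.2 j))
  left_inv p := by
    refine Prod.ext (by simp) (Prod.ext rfl ?_)
    ext j
    have := j.2
    simp [embed, this]
  right_inv q := by
    refine Prod.ext rfl ?_
    ext j
    by_cases h : j = i
    · subst h; simp
    · simp [embed, h]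
  continuous_toFun := by
    have : Continuous fun p : ℝ × (ℝ × ({j : Fin n // j ≠ i} → ℝ)) => (p.1, p.2.2) := by fun_prop
    exact (by fun_prop : Continuous
      fun p : ℝ × (ℝ × ({j : Fin n // j ≠ i} → ℝ)) => p.2.1).prodMk ((continuous_embed i).comp this)
  continuous_invFun := by fun_prop

lemma splitHomeo_apply (p : ℝ × (ℝ × ({j : Fin n // j ≠ i} → ℝ))) :
    splitHomeo i p = (p.2.1, embed i p.1 p.2.2) := rfl

lemma measurePreserving_splitHomeo : MeasurePreserving (splitHomeo i) := by
  let Y := {j : Fin n // j ≠ i} → ℝ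
  have h1 : MeasurePreserving (MeasurableEquiv.prodAssoc (α := ℝ) (β := ℝ) (γ := Y)) :=
    volume_preserving_prodAssoc
  have h2 : MeasurePreserving (Prod.map (Prod.swap : ℝ × ℝ → ℝ × ℝ) (id : Y → Y)) :=
    Measure.measurePreserving_swap.prod (MeasurePreserving.id volume)
  have h3 : MeasurePreserving (Prod.map (id : ℝ → ℝ) fun p : ℝ × Y => embed i p.1 p.2) :=
    (MeasurePreserving.id volume).prod (measurePreserving_embed i)
  exact h3.comp (h1.comp (h2.comp h1.symm))

lemma spDot_embed (t σ a r : ℝ) (y z : {j : Fin n // j ≠ i} → ℝ) :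
    spDot (t, embed i a y) (σ, embed i r z) = a * r + spDot (t, y) (σ, z) := by
  simp only [spDot, sum_embed i (fun u v => u * v)]
  ring

variable {i} {h : ℝ × (Fin n → ℝ) → ℂ}

/-- The Fourier transform in the space variables. -/
def spaceFourier (h : ℝ × (Fin n → ℝ) → ℂ) (τ : ℝ) (η : Fin n → ℝ) : ℂ :=
  ∫ x, e (-(2 * Real.pi * ∑ j, x j * η j)) * h (τ, x)

lemma spaceFourier_slice (hh : Continuous h) (hc : HasCompactSupport h) (η : Fin n → ℝ) :
    Continuous (fun τ => spaceFourier h τ η) ∧ HasCompactSupport (fun τ => spaceFourier h τ η) :=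
  continuous_integral_of_hasCompactSupport
    (h := fun p : ℝ × (Fin n → ℝ) => e (-(2 * Real.pi * ∑ j, p.2 j * η j)) * h p)
    (by fun_prop) hc.mul_left

lemma fourier_spaceFourier (hh : Continuous h) (hc : HasCompactSupport h)
    (η : Fin n → ℝ) (σ : ℝ) :
    𝓕 (fun τ => spaceFourier h τ η) σ = prodFourier h (σ, η) := by
  have hInt : Integrable fun q => e (-(2 * Real.pi * spDot q (σ, η))) * h q :=
    integrable_e_mul (by have := continuous_spDot (σ, η); fun_prop)
      (hh.integrable_of_hasCompactSupport hc)
  rw [fourier_eq_integral_e, prodFourier]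
  rw [Measure.volume_eq_prod] at hInt ⊢
  rw [integral_prod _ hInt]
  congr 1; ext τ
  rw [spaceFourier, ← integral_const_mul]
  congr 1; ext x
  rw [← mul_assoc, ← e_add, spDot]
  congr 2; ring

lemma prodFourier_slice (hh : Continuous h) (hc : HasCompactSupport h)
    (q : ℝ × ({j : Fin n // j ≠ i} → ℝ)) :
    Continuous (fun a => prodFourier (fun p => h (p.1, embed i a p.2)) q) ∧
      HasCompactSupport (fun a => prodFourier (fun p => h (p.1, embed i a p.2)) q) := by
  have h1 : Continuous (h ∘ splitHomeo i) := hh.comp (splitHomeo i).continuous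
  have h2 : HasCompactSupport (h ∘ splitHomeo i) := hc.comp_homeomorph _
  have h3 := continuous_spDot q
  exact continuous_integral_of_hasCompactSupport
    (h := fun p : ℝ × (ℝ × ({j : Fin n // j ≠ i} → ℝ)) =>
      e (-(2 * Real.pi * spDot p.2 q)) * (h ∘ splitHomeo i) p)
    (by have := h3.comp (continuous_snd (X := ℝ)); fun_prop) h2.mul_left

lemma fourier_prodFourier (hh : Continuous h) (hc : HasCompactSupport h)
    (σ r : ℝ) (z : {j : Fin n // j ≠ i} → ℝ) :
    𝓕 (fun a => prodFourier (fun p => h (p.1, embed i a p.2)) (σ, z)) r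
      = prodFourier h (σ, embed i r z) := by
  have hInt : Integrable fun q => e (-(2 * Real.pi * spDot q (σ, embed i r z))) * h q :=
    integrable_e_mul (by have := continuous_spDot (σ, embed i r z); fun_prop)
      (hh.integrable_of_hasCompactSupport hc)
  have hInt' := ((measurePreserving_splitHomeo i).integrable_comp_emb
    (splitHomeo i).measurableEmbedding).2 hInt
  rw [fourier_eq_integral_e, prodFourier, ← (measurePreserving_splitHomeo i).integral_comp
    (splitHomeo i).measurableEmbedding]
  rw [Measure.volume_eq_prod] at hInt'
  conv_rhs => rw [Measure.volume_eq_prod]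
  refine Eq.trans ?_ (integral_prod _ hInt').symm
  congr 1; ext a
  rw [prodFourier, ← integral_const_mul]
  congr 1; ext p
  obtain ⟨τ, y⟩ := p
  simp only [Function.comp, splitHomeo_apply]
  rw [← mul_assoc, ← e_add, spDot_embed]
  congr 2; ring

lemma integrable_fourier_spaceFourier (hs : ContDiff ℝ (⊤ : ℕ∞) h) (hc : HasCompactSupport h)
    (η : Fin n → ℝ) : Integrable (fun σ => prodFourier h (σ, η)) := by
  obtain ⟨C, -, hC⟩ := exists_norm_prodFourier_le hs hc 0
  have hcont := continuous_prodFourier (hs.continuous.integrable_of_hasCompactSupport hc)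
  refine (integrable_inv_one_add_sq.const_mul C).mono'
    (by fun_prop : Continuous fun σ => prodFourier h (σ, η)).aestronglyMeasurable
    (Filter.Eventually.of_forall fun σ => ?_)
  simpa using hC σ η

lemma spaceFourier_eq (hs : ContDiff ℝ (⊤ : ℕ∞) h) (hc : HasCompactSupport h)
    (τ : ℝ) (η : Fin n → ℝ) :
    spaceFourier h τ η = ∫ σ, e (2 * Real.pi * (σ * τ)) * prodFourier h (σ, η) := by
  obtain ⟨h1, h2⟩ := spaceFourier_slice hs.continuous hc η
  have hF : 𝓕 (fun τ => spaceFourier h τ η) = fun σ => prodFourier h (σ, η) :=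
    funext fun σ => fourier_spaceFourier hs.continuous hc η σ
  have := congrFun (h1.fourierInv_fourier_eq (h1.integrable_of_hasCompactSupport h2)
    (by rw [hF]; exact integrable_fourier_spaceFourier hs hc η)) τ
  rw [← this, fourierInv_eq_integral_e, hF]

lemma continuous_spaceFourier (hs : ContDiff ℝ (⊤ : ℕ∞) h) (hc : HasCompactSupport h) :
    Continuous fun p : ℝ × (Fin n → ℝ) => spaceFourier h p.1 p.2 := by
  obtain ⟨C, -, hC⟩ := exists_norm_prodFourier_le hs hc 0
  have hcont := continuous_prodFourier (hs.continuous.integrable_of_hasCompactSupport hc)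
  simp only [spaceFourier_eq hs hc]
  refine continuous_of_dominated (bound := fun σ => C * (1 + σ ^ 2)⁻¹) (fun p => ?_)
    (fun p => ?_) (integrable_inv_one_add_sq.const_mul C) ?_
  · exact (by fun_prop : Continuous fun σ =>
      e (2 * Real.pi * (σ * p.1)) * prodFourier h (σ, p.2)).aestronglyMeasurable
  · refine Filter.Eventually.of_forall fun σ => ?_
    rw [norm_e_mul]
    simpa using hC σ p.2
  · exact Filter.Eventually.of_forall fun σ => by fun_prop

lemma exists_norm_spaceFourier_le (hs : ContDiff ℝ (⊤ : ℕ∞) h) (hc : HasCompactSupport h)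
    (k : ℕ) : ∃ C, 0 < C ∧ ∀ τ η, ‖spaceFourier h τ η‖ ≤ C * ((1 + ‖η‖) ^ k)⁻¹ := by
  obtain ⟨C, hC0, hC⟩ := exists_norm_prodFourier_le hs hc k
  refine ⟨C * Real.pi, by positivity, fun τ η => ?_⟩
  rw [spaceFourier_eq hs hc]
  refine (norm_integral_le_of_norm_le (g := fun σ => C * ((1 + ‖η‖) ^ k)⁻¹ * (1 + σ ^ 2)⁻¹)
    (integrable_inv_one_add_sq.const_mul _) (Filter.Eventually.of_forall fun σ => ?_)).trans_eq ?_
  · rw [norm_e_mul]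
    exact (hC σ η).trans_eq (by ring)
  · rw [integral_const_mul, integral_univ_inv_one_add_sq]
    ring

end Slices

/-- The causal Duhamel integral as a Fourier multiplier in time. -/
lemma integral_Ioc_exp_mul {z : ℂ} (hz : 0 < z.re) {Φ : ℝ → ℂ} (hΦ : Continuous Φ)
    (hΦc : HasCompactSupport Φ) (hΦ' : Integrable (𝓕 Φ)) (hΦ0 : ∀ τ ≤ 0, Φ τ = 0) (t : ℝ) :
    ∫ τ in Set.Ioc 0 t, Complex.exp (-z * (t - τ)) * Φ τ
      = ∫ σ, e (2 * Real.pi * (t * σ)) * (𝓕 Φ σ / (z + 2 * Real.pi * σ * Complex.I)) := by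
  have hconv := integral_e_mul_fourier_mul_fourier (integrable_causalExp hz) hΦ
    (hΦ.integrable_of_hasCompactSupport hΦc) hΦ' t
  simp only [fourier_causalExp hz] at hconv
  calc _ = ∫ τ, causalExp z (t - τ) * Φ τ := by
        rw [integral_Ioc_eq_integral_Ioo, ← integral_indicator measurableSet_Ioo]
        congr 1; ext τ
        by_cases h0 : τ ≤ 0
        · simp [hΦ0 τ h0]
        · by_cases ht : τ < t
          · simp [causalExp, not_le.1 h0, ht]
          · simp [causalExp, ht]
    _ = ∫ b, causalExp z b * Φ (t - b) := by
        rw [← integral_sub_left_eq_self (fun b => causalExp z b * Φ (t - b)) volume t]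
        simp
    _ = _ := by
        rw [← hconv]
        congr 1; ext σ
        rw [div_eq_inv_mul]

section Duhamel

variable {n : ℕ} {f : ℝ → (Fin n → ℝ) → ℂ}

lemma FT_two_pi_smul (τ : ℝ) (η : Fin n → ℝ) :
    FT (f τ) ((2 * Real.pi) • η) = spaceFourier (fun p => f p.1 p.2) τ η := by
  rw [FT, spaceFourier]
  congr 1; ext x
  congr 3
  simp only [Pi.smul_apply, smul_eq_mul, Finset.mul_sum]
  exact Finset.sum_congr rfl fun j _ => by ring

lemma AnuD_eq_integral_spaceFourier (ν : ℝ) (i : Fin n) (t : ℝ) (x : Fin n → ℝ) :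
    AnuD ν i f t x = ∫ τ in Set.Ioc 0 t, ∫ η : Fin n → ℝ,
      2 * Real.pi * η i * Complex.I * e (2 * Real.pi * ∑ j, x j * η j) *
        (Complex.exp (-((ν + Complex.I) * (4 * Real.pi ^ 2 * (∑ j, η j ^ 2 : ℝ))) * (t - τ)) *
          spaceFourier (fun p => f p.1 p.2) τ η) := by
  have hpi : (0 : ℝ) ≤ 2 * Real.pi := by positivity
  rw [AnuD]
  congr 1; ext τ
  have := Measure.integral_comp_smul_of_nonneg (volume : Measure (Fin n → ℝ))
    (fun ξ : Fin n → ℝ => (Complex.I * (ξ i : ℂ)) *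
        e ((∑ j, x j * ξ j) - (t - τ) * (∑ j, ξ j ^ 2)) *
          (Real.exp (-(ν * (t - τ) * (∑ j, ξ j ^ 2))) : ℂ) * FT (f τ) ξ) (2 * Real.pi) (hR := hpi)
  rw [Module.finrank_fin_fun] at this
  rw [← this]
  congr 1; ext η
  rw [FT_two_pi_smul, ← mul_assoc]
  congr 1
  have h1 : ∑ j, x j * ((2 * Real.pi) • η) j = 2 * Real.pi * ∑ j, x j * η j := by
    simp only [Pi.smul_apply, smul_eq_mul, Finset.mul_sum]
    exact Finset.sum_congr rfl fun j _ => by ring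
  have h2 : ∑ j, ((2 * Real.pi) • η) j ^ 2 = 4 * Real.pi ^ 2 * ∑ j, η j ^ 2 := by
    simp only [Pi.smul_apply, smul_eq_mul, Finset.mul_sum]
    exact Finset.sum_congr rfl fun j _ => by ring
  rw [h1, h2, sub_eq_add_neg (2 * Real.pi * _), e_add]
  set s := ∑ j, η j ^ 2
  have h3 : e (-((t - τ) * (4 * Real.pi ^ 2 * s))) *
      (Real.exp (-(ν * (t - τ) * (4 * Real.pi ^ 2 * s))) : ℂ) =
      Complex.exp (-((ν + Complex.I) * (4 * Real.pi ^ 2 * (s : ℝ))) * (t - τ)) := by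
    rw [e, Complex.ofReal_exp, ← Complex.exp_add]
    congr 1
    push_cast
    ring
  rw [← h3]
  simp only [Pi.smul_apply, smul_eq_mul]
  push_cast
  ring

/-- The space-time Fourier transform of `∂_i u`, where `u` solves the Ginzburg–Landau equation
with source `h`. -/
def duhamelMultiplier (ν : ℝ) (i : Fin n) (h : ℝ × (Fin n → ℝ) → ℂ) (p : ℝ × (Fin n → ℝ)) : ℂ :=
  2 * Real.pi * p.2 i * Complex.I * prodFourier h p / glSymbol ν p.1 (∑ j, p.2 j ^ 2)

lemma integrable_duhamelMultiplier {ν : ℝ} (hν : 0 < ν) (i : Fin n) {h : ℝ × (Fin n → ℝ) → ℂ}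
    (hs : ContDiff ℝ (⊤ : ℕ∞) h) (hc : HasCompactSupport h) :
    Integrable (duhamelMultiplier ν i h) := by
  obtain ⟨C, -, hC⟩ := exists_norm_prodFourier_le hs hc (n + 1)
  exact integrable_multiplier i hν
    (continuous_prodFourier (hs.continuous.integrable_of_hasCompactSupport hc)) hC

lemma integral_Ioc_duhamel {ν : ℝ} (hν : 0 < ν) (i : Fin n) {h : ℝ × (Fin n → ℝ) → ℂ}
    (hs : ContDiff ℝ (⊤ : ℕ∞) h) (hc : HasCompactSupport h) (h0 : ∀ τ ≤ 0, ∀ x, h (τ, x) = 0)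
    (t : ℝ) (η : Fin n → ℝ) :
    2 * Real.pi * η i * Complex.I *
      ∫ τ in Set.Ioc 0 t,
        Complex.exp (-((ν + Complex.I) * (4 * Real.pi ^ 2 * (∑ j, η j ^ 2 : ℝ))) * (t - τ)) *
          spaceFourier h τ η
      = ∫ σ, e (2 * Real.pi * (t * σ)) * duhamelMultiplier ν i h (σ, η) := by
  by_cases hη : η i = 0
  · simp [duhamelMultiplier, hη]
  have hs0 : 0 < ∑ j, η j ^ 2 :=
    Finset.sum_pos' (fun j _ => sq_nonneg _) ⟨i, Finset.mem_univ _, by positivity⟩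
  set s := ∑ j, η j ^ 2
  have hre : 0 < ((ν + Complex.I) * (4 * Real.pi ^ 2 * (s : ℝ)) : ℂ).re := by
    have : ((ν + Complex.I) * (4 * Real.pi ^ 2 * (s : ℝ)) : ℂ).re = ν * (4 * Real.pi ^ 2 * s) := by
      have h4 : (4 * Real.pi ^ 2 * (s : ℝ) : ℂ) = ((4 * Real.pi ^ 2 * s : ℝ) : ℂ) := by push_cast; rfl
      rw [h4, Complex.re_mul_ofReal]
      simp
    rw [this]; positivity
  have hF : (𝓕 fun τ => spaceFourier h τ η) = fun σ => prodFourier h (σ, η) :=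
    funext fun σ => fourier_spaceFourier hs.continuous hc η σ
  obtain ⟨hΦ, hΦc⟩ := spaceFourier_slice hs.continuous hc η
  rw [integral_Ioc_exp_mul hre hΦ hΦc (hF ▸ integrable_fourier_spaceFourier hs hc η)
    (fun τ hτ => by simp [spaceFourier, h0 τ hτ]) t, ← integral_const_mul, hF]
  congr 1; ext σ
  rw [duhamelMultiplier, glSymbol]
  ring

lemma AnuD_eq_integral_duhamelMultiplier {ν : ℝ} (hν : 0 < ν) (i : Fin n)
    (hs : ContDiff ℝ (⊤ : ℕ∞) fun p : ℝ × (Fin n → ℝ) => f p.1 p.2)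
    (hc : HasCompactSupport fun p : ℝ × (Fin n → ℝ) => f p.1 p.2)
    (h0 : ∀ τ ≤ 0, ∀ x, f τ x = 0) (t : ℝ) (x : Fin n → ℝ) :
    AnuD ν i f t x = ∫ p, e (2 * Real.pi * spDot (t, x) p) *
      duhamelMultiplier ν i (fun p => f p.1 p.2) p := by
  rw [AnuD_eq_integral_spaceFourier]
  set h : ℝ × (Fin n → ℝ) → ℂ := fun p => f p.1 p.2 with hh
  obtain ⟨C, hC0, hC⟩ := exists_norm_spaceFourier_le hs hc (n + 2)
  have hInt : Integrable (Function.uncurry fun (τ : ℝ) (η : Fin n → ℝ) =>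
      2 * Real.pi * η i * Complex.I * e (2 * Real.pi * ∑ j, x j * η j) *
        (Complex.exp (-((ν + Complex.I) * (4 * Real.pi ^ 2 * (∑ j, η j ^ 2 : ℝ))) * (t - τ)) *
          spaceFourier h τ η)) ((volume.restrict (Set.Ioc 0 t)).prod volume) := by
    have hdom : Integrable (fun p : ℝ × (Fin n → ℝ) => (2 * Real.pi * C) *
        ((1 : ℝ) * ((1 + ‖p.2‖) ^ (n + 1))⁻¹)) ((volume.restrict (Set.Ioc 0 t)).prod volume) :=
      (Integrable.mul_prod (f := fun _ : ℝ => (1 : ℝ)) (integrable_const 1)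
        (integrable_inv_one_add_norm_pow n)).const_mul _
    refine hdom.mono' ?_ ?_
    · have h1 := continuous_spaceFourier hs hc
      refine Continuous.aestronglyMeasurable ?_
      simp only [Function.uncurry_def]
      fun_prop
    · have hmem : ∀ᵐ p : ℝ × (Fin n → ℝ) ∂((volume.restrict (Set.Ioc 0 t)).prod volume),
          p.1 ∈ Set.Ioc 0 t :=
        Measure.quasiMeasurePreserving_fst.ae (ae_restrict_mem measurableSet_Ioc)
      filter_upwards [hmem] with ⟨τ, η⟩ hτ
      simp only [Function.uncurry_apply_pair]
      have hexp : ‖Complex.exp (-((ν + Complex.I) * (4 * Real.pi ^ 2 * (∑ j, η j ^ 2 : ℝ))) *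
          (t - τ))‖ ≤ 1 := by
        rw [Complex.norm_exp, Real.exp_le_one_iff]
        set s := ∑ j, η j ^ 2 with hs
        have hs0 : 0 ≤ s := Finset.sum_nonneg fun j _ => sq_nonneg _
        have : (-((ν + Complex.I) * (4 * Real.pi ^ 2 * (s : ℝ))) * (t - τ) : ℂ) =
            (ν + Complex.I) * ((-(4 * Real.pi ^ 2 * s * (t - τ)) : ℝ) : ℂ) := by push_cast; ring
        rw [this, Complex.re_mul_ofReal]
        have h3 : 0 ≤ t - τ := sub_nonneg.2 hτ.2
        have : 0 ≤ 4 * Real.pi ^ 2 * s * (t - τ) := by positivity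
        simp only [Complex.add_re, Complex.ofReal_re, Complex.I_re, add_zero]
        nlinarith
      have hη : |η i| ≤ 1 + ‖η‖ := by
        have := norm_le_pi_norm η i
        rw [Real.norm_eq_abs] at this
        linarith
      have hpos : 0 < 1 + ‖η‖ := by positivity
      calc _ = 2 * Real.pi * |η i| * (‖Complex.exp (-((ν + Complex.I) *
              (4 * Real.pi ^ 2 * (∑ j, η j ^ 2 : ℝ))) * (t - τ))‖ * ‖spaceFourier h τ η‖) := by
            simp only [norm_mul, norm_e, Complex.norm_I, mul_one, Complex.norm_real,
              Complex.norm_ofNat, Real.norm_eq_abs, abs_of_pos Real.pi_pos]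
        _ ≤ 2 * Real.pi * (1 + ‖η‖) * (1 * (C * ((1 + ‖η‖) ^ (n + 2))⁻¹)) := by
            gcongr
            exact hC τ η
        _ = _ := by
            rw [pow_succ (1 + ‖η‖) (n + 1)]
            field_simp
  rw [integral_integral_swap hInt]
  have hJ := integrable_e_mul (u := fun p => 2 * Real.pi * spDot (t, x) p)
    (by have := continuous_spDot_right (t, x); fun_prop) (integrable_duhamelMultiplier hν i hs hc)
  rw [Measure.volume_eq_prod] at hJ ⊢
  rw [integral_prod_symm _ hJ]
  congr 1; ext η
  rw [integral_const_mul, mul_right_comm, integral_Ioc_duhamel hν i hs hc h0, mul_comm,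
    ← integral_const_mul]
  congr 1; ext σ
  rw [← mul_assoc, ← e_add, spDot]
  congr 2; ring

end Duhamel

section SliceMultiplier

variable {n : ℕ} {ν : ℝ} {i : Fin n} {h : ℝ × (Fin n → ℝ) → ℂ}

/-- The transform of `duhamelMultiplier` back to the physical variable in the `i`-th direction. -/
def sliceMultiplier (ν : ℝ) (i : Fin n) (h : ℝ × (Fin n → ℝ) → ℂ) (a : ℝ)
    (q : ℝ × ({j : Fin n // j ≠ i} → ℝ)) : ℂ :=
  ∫ r, e (2 * Real.pi * (a * r)) * duhamelMultiplier ν i h (q.1, embed i r q.2)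

lemma integrable_duhamelMultiplier_comp_splitHomeo (hν : 0 < ν)
    (hs : ContDiff ℝ (⊤ : ℕ∞) h) (hc : HasCompactSupport h) :
    Integrable fun p => duhamelMultiplier ν i h (splitHomeo i p) :=
  (measurePreserving_splitHomeo i).integrable_comp_of_integrable
    (integrable_duhamelMultiplier hν i hs hc)

lemma integrable_sliceMultiplier (hν : 0 < ν) (hs : ContDiff ℝ (⊤ : ℕ∞) h)
    (hc : HasCompactSupport h) (a : ℝ) : Integrable (sliceMultiplier ν i h a) := by
  have h1 := integrable_e_mul
    (u := fun p : ℝ × (ℝ × ({j : Fin n // j ≠ i} → ℝ)) => 2 * Real.pi * (a * p.1))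
    (by fun_prop) (integrable_duhamelMultiplier_comp_splitHomeo (i := i) hν hs hc)
  rw [Measure.volume_eq_prod] at h1
  exact h1.integral_prod_right

lemma integral_duhamelMultiplier_embed (hν : 0 < ν) (hs : ContDiff ℝ (⊤ : ℕ∞) h)
    (hc : HasCompactSupport h) (t a : ℝ) (y : {j : Fin n // j ≠ i} → ℝ) :
    ∫ p, e (2 * Real.pi * spDot (t, embed i a y) p) * duhamelMultiplier ν i h p
      = ∫ q, e (2 * Real.pi * spDot (t, y) q) * sliceMultiplier ν i h a q := by
  have h1 := integrable_e_mul
    (u := fun p => 2 * Real.pi * spDot (t, embed i a y) (splitHomeo i p))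
    (by
      have := (continuous_spDot_right (t, embed i a y)).comp (splitHomeo i).continuous
      exact this.const_mul _)
    (integrable_duhamelMultiplier_comp_splitHomeo (i := i) hν hs hc)
  rw [← (measurePreserving_splitHomeo i).integral_comp (splitHomeo i).measurableEmbedding]
  rw [Measure.volume_eq_prod] at h1 ⊢
  rw [integral_prod_symm _ h1]
  congr 1; ext q
  rw [sliceMultiplier, ← integral_const_mul]
  congr 1; ext r
  rw [splitHomeo_apply, spDot_embed, ← mul_assoc, ← e_add]
  congr 2; ring

lemma integrable_prodFourier_embed (hs : ContDiff ℝ (⊤ : ℕ∞) h) (hc : HasCompactSupport h)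
    (σ : ℝ) (z : {j : Fin n // j ≠ i} → ℝ) :
    Integrable fun r => prodFourier h (σ, embed i r z) := by
  obtain ⟨C, hC0, hC⟩ := exists_norm_prodFourier_le hs hc 2
  have hcont : Continuous fun r => prodFourier h (σ, embed i r z) := by
    have h1 := continuous_prodFourier (hs.continuous.integrable_of_hasCompactSupport hc)
    have h2 : Continuous fun r : ℝ => embed i r z :=
      (continuous_embed i).comp (by fun_prop : Continuous fun r : ℝ => (r, z))
    fun_prop
  refine (integrable_inv_one_add_sq.const_mul (C * (1 + σ ^ 2)⁻¹)).mono'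
    hcont.aestronglyMeasurable (.of_forall fun r => (hC _ _).trans ?_)
  rw [← mul_assoc]
  have h3 : |r| ≤ ‖embed i r z‖ := by simpa using norm_le_pi_norm (embed i r z) i
  gcongr
  nlinarith [abs_nonneg r, sq_abs r]

lemma norm_sliceMultiplier_le (hν : 0 < ν) (hs : ContDiff ℝ (⊤ : ℕ∞) h)
    (hc : HasCompactSupport h) (a : ℝ) {q : ℝ × ({j : Fin n // j ≠ i} → ℝ)} (hq : q.1 ≠ 0) :
    ‖sliceMultiplier ν i h a q‖
      ≤ 2⁻¹ * ∫ b, ‖prodFourier (fun p => h (p.1, embed i b p.2)) q‖ := by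
  obtain ⟨hg, hgc⟩ := prodFourier_slice (i := i) hs.continuous hc q
  have hF : (𝓕 fun b => prodFourier (fun p => h (p.1, embed i b p.2)) q)
      = fun r => prodFourier h (q.1, embed i r q.2) :=
    funext fun r => fourier_prodFourier hs.continuous hc q.1 r q.2
  have key := norm_integral_resolvent_le (s := ∑ j, q.2 j ^ 2) hν hq hg
    (hg.integrable_of_hasCompactSupport hgc) (hF ▸ integrable_prodFourier_embed hs hc q.1 q.2) a
  rw [hF] at key
  refine le_trans (le_of_eq ?_) key
  rw [sliceMultiplier]
  congr 2; ext r
  simp only [duhamelMultiplier, embed_self, sum_embed i (fun u _ => u ^ 2) r r q.2 q.2]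

lemma continuous_slice (hh : Continuous h) (a : ℝ) :
    Continuous fun p : ℝ × ({j : Fin n // j ≠ i} → ℝ) => h (p.1, embed i a p.2) :=
  hh.comp ((splitHomeo i).continuous.comp (by fun_prop : Continuous fun p => (a, p)))

lemma hasCompactSupport_comp_splitHomeo (hc : HasCompactSupport h) :
    HasCompactSupport fun p => h (splitHomeo i p) :=
  hc.comp_homeomorph (splitHomeo i)

lemma hasCompactSupport_slice (hc : HasCompactSupport h) (a : ℝ) :
    HasCompactSupport fun p : ℝ × ({j : Fin n // j ≠ i} → ℝ) => h (p.1, embed i a p.2) := by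
  refine HasCompactSupport.comp_isClosedEmbedding (hasCompactSupport_comp_splitHomeo (i := i) hc)
    (g := Prod.mk a) ⟨isEmbedding_prodMkRight a, ?_⟩
  rw [show Set.range (Prod.mk a) = {a} ×ˢ Set.univ by ext ⟨b, p⟩; simp [eq_comm]]
  exact isClosed_singleton.prod isClosed_univ

lemma lintegral_prodFourier_slice_sq (hh : Continuous h) (hc : HasCompactSupport h) (a : ℝ) :
    ∫⁻ q, ‖prodFourier (fun p => h (p.1, embed i a p.2)) q‖ₑ ^ 2
      = ∫⁻ p : ℝ × ({j : Fin n // j ≠ i} → ℝ), ‖h (p.1, embed i a p.2)‖ₑ ^ 2 :=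
  lintegral_prodFourier_sq
    ((continuous_slice hh a).integrable_of_hasCompactSupport (hasCompactSupport_slice hc a))
    ((continuous_slice hh a).memLp_of_hasCompactSupport (hasCompactSupport_slice hc a))

lemma measurable_prodFourier_slice (hh : Continuous h) :
    Measurable (Function.uncurry fun (q : ℝ × ({j : Fin n // j ≠ i} → ℝ)) (a : ℝ) =>
      ‖prodFourier (fun p => h (p.1, embed i a p.2)) q‖ₑ) := by
  refine Measurable.enorm (StronglyMeasurable.measurable ?_)
  simp only [prodFourier]
  refine StronglyMeasurable.integral_prod_right
    (f := fun x : (ℝ × ({j : Fin n // j ≠ i} → ℝ)) × ℝ =>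
      fun p : ℝ × ({j : Fin n // j ≠ i} → ℝ) =>
        e (-(2 * Real.pi * spDot p x.1)) * h (p.1, embed i x.2 p.2))
    (Continuous.stronglyMeasurable ?_)
  have h1 : Continuous fun x : ((ℝ × ({j : Fin n // j ≠ i} → ℝ)) × ℝ) ×
      (ℝ × ({j : Fin n // j ≠ i} → ℝ)) => h (splitHomeo i (x.1.2, x.2)) :=
    hh.comp ((splitHomeo i).continuous.comp (by fun_prop))
  have h2 : Continuous fun x : ((ℝ × ({j : Fin n // j ≠ i} → ℝ)) × ℝ) ×
      (ℝ × ({j : Fin n // j ≠ i} → ℝ)) => e (-(2 * Real.pi * spDot x.2 x.1.1)) := by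
    simp only [spDot]; fun_prop
  exact h2.mul h1

lemma lintegral_sliceMultiplier_sq_le (hν : 0 < ν) (hs : ContDiff ℝ (⊤ : ℕ∞) h)
    (hc : HasCompactSupport h) (a : ℝ) :
    ∫⁻ q, ‖sliceMultiplier ν i h a q‖ₑ ^ 2
      ≤ (∫⁻ b, (∫⁻ p : ℝ × ({j : Fin n // j ≠ i} → ℝ),
          ‖h (p.1, embed i b p.2)‖ₑ ^ 2) ^ ((1 : ℝ) / 2)) ^ 2 := by
  calc _ ≤ ∫⁻ q, (∫⁻ b, ‖prodFourier (fun p => h (p.1, embed i b p.2)) q‖ₑ) ^ 2 := by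
        refine lintegral_mono_ae (ae_fst_ne_zero.mono fun q hq => ?_)
        gcongr
        obtain ⟨hg, hgc⟩ := prodFourier_slice (i := i) hs.continuous hc q
        rw [← ofReal_integral_norm_eq_lintegral_enorm (hg.integrable_of_hasCompactSupport hgc),
          ← ofReal_norm]
        refine ENNReal.ofReal_le_ofReal ((norm_sliceMultiplier_le hν hs hc a hq).trans ?_)
        have : 0 ≤ ∫ b, ‖prodFourier (fun p => h (p.1, embed i b p.2)) q‖ :=
          integral_nonneg fun _ => norm_nonneg _
        linarith
    _ ≤ _ := lintegral_lintegral_sq_le (measurable_prodFourier_slice hs.continuous)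
    _ = _ := by simp only [lintegral_prodFourier_slice_sq hs.continuous hc]

lemma continuous_integral_slice_sq (hh : Continuous h) (hc : HasCompactSupport h) :
    Continuous (fun b => ∫ p : ℝ × ({j : Fin n // j ≠ i} → ℝ), ‖h (p.1, embed i b p.2)‖ ^ 2) ∧
      HasCompactSupport
        (fun b => ∫ p : ℝ × ({j : Fin n // j ≠ i} → ℝ), ‖h (p.1, embed i b p.2)‖ ^ 2) :=
  continuous_integral_of_hasCompactSupport
    (h := fun x : ℝ × (ℝ × ({j : Fin n // j ≠ i} → ℝ)) => ‖h (splitHomeo i x)‖ ^ 2)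
    ((hh.comp (splitHomeo i).continuous).norm.pow 2)
    ((hasCompactSupport_comp_splitHomeo hc).comp_left (g := fun z => ‖z‖ ^ 2) (by simp))

lemma integrable_slice_sq (hh : Continuous h) (hc : HasCompactSupport h) (b : ℝ) :
    Integrable fun p : ℝ × ({j : Fin n // j ≠ i} → ℝ) => ‖h (p.1, embed i b p.2)‖ ^ 2 := by
  have h1 : Continuous fun p : ℝ × ({j : Fin n // j ≠ i} → ℝ) => ‖h (p.1, embed i b p.2)‖ ^ 2 :=
    (continuous_slice hh b).norm.pow 2
  have h2 : HasCompactSupport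
      fun p : ℝ × ({j : Fin n // j ≠ i} → ℝ) => ‖h (p.1, embed i b p.2)‖ ^ 2 :=
    (hasCompactSupport_slice hc b).comp_left (g := fun z : ℂ => ‖z‖ ^ 2) (by simp)
  exact h1.integrable_of_hasCompactSupport h2

lemma lintegral_slice_sq (hh : Continuous h) (hc : HasCompactSupport h) (b : ℝ) :
    ∫⁻ p : ℝ × ({j : Fin n // j ≠ i} → ℝ), ‖h (p.1, embed i b p.2)‖ₑ ^ 2
      = ENNReal.ofReal
          (∫ p : ℝ × ({j : Fin n // j ≠ i} → ℝ), ‖h (p.1, embed i b p.2)‖ ^ 2) := by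
  have hInt : Integrable fun p : ℝ × ({j : Fin n // j ≠ i} → ℝ) => ‖h (p.1, embed i b p.2)‖ ^ 2 :=
    integrable_slice_sq hh hc b
  rw [ofReal_integral_eq_lintegral_ofReal hInt (.of_forall fun p => sq_nonneg _)]
  refine lintegral_congr fun p => ?_
  rw [ENNReal.ofReal_pow (norm_nonneg _), ofReal_norm]

lemma lintegral_rpow_slice_sq (hh : Continuous h) (hc : HasCompactSupport h) :
    ∫⁻ b, (∫⁻ p : ℝ × ({j : Fin n // j ≠ i} → ℝ),
        ‖h (p.1, embed i b p.2)‖ₑ ^ 2) ^ ((1 : ℝ) / 2)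
      = ENNReal.ofReal (∫ b, (∫ p : ℝ × ({j : Fin n // j ≠ i} → ℝ),
          ‖h (p.1, embed i b p.2)‖ ^ 2) ^ ((1 : ℝ) / 2)) := by
  have hnn : ∀ b, 0 ≤ ∫ p : ℝ × ({j : Fin n // j ≠ i} → ℝ), ‖h (p.1, embed i b p.2)‖ ^ 2 :=
    fun b => integral_nonneg fun p => by positivity
  obtain ⟨h1, h2⟩ := continuous_integral_slice_sq (i := i) hh hc
  rw [ofReal_integral_eq_lintegral_ofReal]
  · congr 1; ext b
    rw [lintegral_slice_sq hh hc, ENNReal.ofReal_rpow_of_nonneg (hnn b) (by norm_num)]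
  · exact (h1.rpow_const fun _ => .inr (by norm_num)).integrable_of_hasCompactSupport
      (h2.comp_left (g := fun u : ℝ => u ^ ((1 : ℝ) / 2)) (Real.zero_rpow (by norm_num)))
  · exact .of_forall fun b => Real.rpow_nonneg (hnn b) _

lemma lintegral_integral_sliceMultiplier_sq_le (hν : 0 < ν) (hs : ContDiff ℝ (⊤ : ℕ∞) h)
    (hc : HasCompactSupport h) (a : ℝ) :
    ∫⁻ p, ‖∫ q, e (2 * Real.pi * spDot p q) * sliceMultiplier ν i h a q‖ₑ ^ 2
      ≤ ENNReal.ofReal (∫ b, (∫ p : ℝ × ({j : Fin n // j ≠ i} → ℝ),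
          ‖h (p.1, embed i b p.2)‖ ^ 2) ^ ((1 : ℝ) / 2)) ^ 2 := by
  have hle := lintegral_sliceMultiplier_sq_le (i := i) hν hs hc a
  rw [lintegral_rpow_slice_sq hs.continuous hc] at hle
  have hInt := integrable_sliceMultiplier (i := i) hν hs hc a
  have hL2 : MemLp (sliceMultiplier ν i h a) 2 volume := by
    refine ⟨hInt.aestronglyMeasurable, ?_⟩
    rw [eLpNorm_lt_top_iff_lintegral_rpow_enorm_lt_top (by norm_num) (by norm_num)]
    have : ∫⁻ q, ‖sliceMultiplier ν i h a q‖ₑ ^ 2 < ⊤ :=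
      hle.trans_lt (by simp)
    simpa using this
  rwa [lintegral_prodFourierInv_sq hInt hL2]

end SliceMultiplier

lemma continuous_integral_e_spDot {ι : Type*} [Fintype ι] {h : ℝ × (ι → ℝ) → ℂ}
    (hh : Integrable h) :
    Continuous fun p : ℝ × (ι → ℝ) => ∫ q, e (2 * Real.pi * spDot p q) * h q := by
  refine continuous_of_dominated (bound := fun q => ‖h q‖) (fun p => ?_)
    (fun p => .of_forall fun q => (norm_e_mul _ _).le) hh.norm (.of_forall fun q => ?_)
  · exact (integrable_e_mul (by have := continuous_spDot_right p; fun_prop) hh).aestronglyMeasurable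
  · have := continuous_spDot q
    fun_prop

lemma setIntegral_integral_sq_le {Y : Type*} [MeasureSpace Y] [SFinite (volume : Measure Y)]
    {u : ℝ → Y → ℂ} (hu : AEStronglyMeasurable (fun p : ℝ × Y => u p.1 p.2)) {M : ℝ} (hM : 0 ≤ M)
    (hle : ∫⁻ p : ℝ × Y, ‖u p.1 p.2‖ₑ ^ 2 ≤ ENNReal.ofReal M ^ 2) (s : Set ℝ) :
    ∫ t in s, ∫ y, ‖u t y‖ ^ 2 ≤ M ^ 2 := by
  have henorm : ∀ p : ℝ × Y, ‖u p.1 p.2‖ₑ ^ 2 = ENNReal.ofReal (‖u p.1 p.2‖ ^ 2) := fun p => by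
    rw [ENNReal.ofReal_pow (norm_nonneg _), ofReal_norm]
  simp only [henorm, ← ENNReal.ofReal_pow hM] at hle
  have hnn : 0 ≤ᵐ[volume] fun p : ℝ × Y => ‖u p.1 p.2‖ ^ 2 := .of_forall fun p => sq_nonneg _
  have hInt : Integrable fun p : ℝ × Y => ‖u p.1 p.2‖ ^ 2 :=
    ⟨hu.norm.pow 2, by
      rw [hasFiniteIntegral_iff_ofReal hnn]
      exact hle.trans_lt ENNReal.ofReal_lt_top⟩
  have hInt' : Integrable (fun p : ℝ × Y => ‖u p.1 p.2‖ ^ 2) (volume.prod volume) := hInt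
  calc ∫ t in s, ∫ y, ‖u t y‖ ^ 2 ≤ ∫ t, ∫ y, ‖u t y‖ ^ 2 :=
        setIntegral_le_integral hInt'.integral_prod_left
          (.of_forall fun t => integral_nonneg fun y => sq_nonneg _)
    _ = ∫ p : ℝ × Y, ‖u p.1 p.2‖ ^ 2 := (integral_prod _ hInt').symm
    _ ≤ M ^ 2 := by
        rw [← ENNReal.ofReal_le_ofReal_iff (sq_nonneg M),
          ofReal_integral_eq_lintegral_ofReal hInt hnn]
        exact hle

end Lemmas

/-- the key uniform (in `ν > 0`) inhomogeneous smoothing estimate with a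
full derivative gained:
`‖∂_{x_i} 𝓐_ν f‖_{L^∞_{x_i} L²_{x̄,t}(ℝ⁺×ℝⁿ)} ≤ C ‖f‖_{L¹_{x_i} L²_{x̄,t}(ℝ⁺×ℝⁿ)}`
for all `f ∈ C_c^∞((0,∞) × ℝⁿ)`. -/
theorem stmt_5 (n : ℕ) (hn : 1 ≤ n) (i : Fin n) :
    ∃ C : ℝ, 0 < C ∧
      ∀ (ν : ℝ), 0 < ν →
      ∀ f : ℝ → (Fin n → ℝ) → ℂ,
        ContDiff ℝ (⊤ : ℕ∞) (fun p : ℝ × (Fin n → ℝ) => f p.1 p.2) →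
        HasCompactSupport (fun p : ℝ × (Fin n → ℝ) => f p.1 p.2) →
        tsupport (fun p : ℝ × (Fin n → ℝ) => f p.1 p.2) ⊆
          Set.Ioi (0 : ℝ) ×ˢ (Set.univ : Set (Fin n → ℝ)) →
        ∀ᵐ a : ℝ ∂volume,
          (∫ t in Set.Ioi (0 : ℝ), ∫ y : {j : Fin n // j ≠ i} → ℝ,
              ‖AnuD ν i f t (embed i a y)‖ ^ 2) ^ ((1 : ℝ) / 2)
            ≤ C * ∫ a' : ℝ,
                (∫ t in Set.Ioi (0 : ℝ), ∫ y : {j : Fin n // j ≠ i} → ℝ,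
                    ‖f t (embed i a' y)‖ ^ 2) ^ ((1 : ℝ) / 2) := by
  refine ⟨1, one_pos, fun ν hν f hs hc hsupp => .of_forall fun a => ?_⟩
  have h0 : ∀ τ ≤ 0, ∀ x, f τ x = 0 := fun τ hτ x => by
    by_contra hne
    have hmem : (τ, x) ∈ tsupport fun p : ℝ × (Fin n → ℝ) => f p.1 p.2 := subset_tsupport _ hne
    exact absurd (hsupp hmem).1 (not_lt.2 hτ)
  have hrhs : ∀ b : ℝ, ∫ t in Set.Ioi (0 : ℝ), ∫ y : {j : Fin n // j ≠ i} → ℝ,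
      ‖f t (embed i b y)‖ ^ 2
        = ∫ p : ℝ × ({j : Fin n // j ≠ i} → ℝ), ‖f p.1 (embed i b p.2)‖ ^ 2 := fun b => by
    rw [setIntegral_eq_integral_of_forall_compl_eq_zero
      fun t ht => by simp [h0 t (not_lt.1 ht)]]
    exact (integral_prod _ (integrable_slice_sq hs.continuous hc b)).symm
  have hlhs : ∀ t (y : {j : Fin n // j ≠ i} → ℝ), AnuD ν i f t (embed i a y)
      = ∫ q, e (2 * Real.pi * spDot (t, y) q) *
          sliceMultiplier ν i (fun p => f p.1 p.2) a q := fun t y => by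
    rw [AnuD_eq_integral_duhamelMultiplier hν i hs hc h0,
      integral_duhamelMultiplier_embed hν hs hc]
  simp only [hrhs, hlhs, one_mul]
  set M := ∫ b, (∫ p : ℝ × ({j : Fin n // j ≠ i} → ℝ),
    ‖f p.1 (embed i b p.2)‖ ^ 2) ^ ((1 : ℝ) / 2)
  have hM : 0 ≤ M := integral_nonneg fun b =>
    Real.rpow_nonneg (integral_nonneg fun p => sq_nonneg _) _
  have key := setIntegral_integral_sq_le
    (u := fun t (y : {j : Fin n // j ≠ i} → ℝ) => ∫ q, e (2 * Real.pi * spDot (t, y) q) *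
      sliceMultiplier ν i (fun p => f p.1 p.2) a q)
    (continuous_integral_e_spDot
      (integrable_sliceMultiplier (i := i) hν hs hc a)).aestronglyMeasurable hM
    (lintegral_integral_sliceMultiplier_sq_le hν hs hc a) (Set.Ioi 0)
  rw [← Real.sqrt_eq_rpow]
  exact Real.sqrt_le_iff.2 ⟨hM, key⟩
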